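/- Suppose the pair (α,u) of an odd superfield α and an even superfield u solves the MRSKdV system, λ₀, λ ∈ ℝ, θ₀ is an even invertible superfield solving the linear system associated with (α,u) at λ₀, and ψ is a superfield solving the linear system associated with (α,u) at λ. Then ψ̂ := Dψ + δ₀ψ satisfies ∂ₜψ̂ = M̂ψ̂. -/

import Mathlib

noncomputable section
open scoped BigOperators

/-- The exterior algebra `Λ` of `ℝ^N`. -/
abbrev SuperAlg (N : ℕ) : Type := ExteriorAlgebra ℝ (Fin N → ℝ)

/-- The even part `Λ₀` of the exterior algebra. -/
def LambdaEven (N : ℕ) : Submodule ℝ (SuperAlg N) :=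
  CliffordAlgebra.evenOdd (0 : QuadraticForm ℝ (Fin N → ℝ)) 0

/-- The odd part `Λ₁` of the exterior algebra. -/
def LambdaOdd (N : ℕ) : Submodule ℝ (SuperAlg N) :=
  CliffordAlgebra.evenOdd (0 : QuadraticForm ℝ (Fin N → ℝ)) 1

/-- A superfield: a pair `(f₀, f₁)` of maps `ℝ² → Λ`, encoding
`f(x,t,ϑ) = f₀(x,t) + ϑ f₁(x,t)`. -/
@[ext] structure SF (N : ℕ) where
  c0 : ℝ → ℝ → SuperAlg N
  c1 : ℝ → ℝ → SuperAlg N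

namespace SF
variable {N : ℕ}

instance : Zero (SF N) := ⟨⟨0, 0⟩⟩
instance : Add (SF N) := ⟨fun f g => ⟨f.c0 + g.c0, f.c1 + g.c1⟩⟩
instance : Neg (SF N) := ⟨fun f => ⟨-f.c0, -f.c1⟩⟩
instance : Sub (SF N) := ⟨fun f g => ⟨f.c0 - g.c0, f.c1 - g.c1⟩⟩
instance : SMul ℕ (SF N) := ⟨fun n f => ⟨n • f.c0, n • f.c1⟩⟩
instance : SMul ℤ (SF N) := ⟨fun n f => ⟨n • f.c0, n • f.c1⟩⟩
instance : SMul ℝ (SF N) := ⟨fun r f => ⟨r • f.c0, r • f.c1⟩⟩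

instance : AddCommGroup (SF N) :=
  Function.Injective.addCommGroup
    (M₂ := (ℝ → ℝ → SuperAlg N) × (ℝ → ℝ → SuperAlg N))
    (fun f => (f.c0, f.c1))
    (fun a b h => by cases a; cases b; simpa using h)
    rfl (fun _ _ => rfl) (fun _ => rfl) (fun _ _ => rfl) (fun _ _ => rfl) (fun _ _ => rfl)

instance : One (SF N) := ⟨⟨fun _ _ => 1, fun _ _ => 0⟩⟩

/-- The product of superfields: `(fg)₀ = f₀g₀`,
`(fg)₁ = f₁g₀ + σ(f₀)g₁` where `σ` is the grade involution of `Λ`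
(this is the bilinear extension of the parity-sign formula for homogeneous factors). -/
instance : Mul (SF N) := ⟨fun f g =>
  ⟨fun x t => f.c0 x t * g.c0 x t,
   fun x t => f.c1 x t * g.c0 x t + CliffordAlgebra.involute (f.c0 x t) * g.c1 x t⟩⟩

/-- An even superfield. -/
def IsEven (f : SF N) : Prop :=
  (∀ x t, f.c0 x t ∈ LambdaEven N) ∧ (∀ x t, f.c1 x t ∈ LambdaOdd N)

/-- An odd superfield. -/
def IsOdd (f : SF N) : Prop :=
  (∀ x t, f.c0 x t ∈ LambdaOdd N) ∧ (∀ x t, f.c1 x t ∈ LambdaEven N)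

/-- A superfield is invertible when `f₀(x,t)` is invertible in `Λ` for all `(x,t)`. -/
def Invertible (f : SF N) : Prop := ∀ x t, IsUnit (f.c0 x t)

/-- The multiplicative inverse of a superfield (junk unless `f` is invertible). -/
def sinv (f : SF N) : SF N :=
  ⟨fun x t => Ring.inverse (f.c0 x t),
   fun x t => -(Ring.inverse (CliffordAlgebra.involute (f.c0 x t)) * f.c1 x t *
      Ring.inverse (f.c0 x t))⟩

end SF

/-- Derivative of a `Λ`-valued function of one real variable, characterized through all
linear functionals (junk value `0` when not differentiable). -/
def derLam {N : ℕ} (g : ℝ → SuperAlg N) (x : ℝ) : SuperAlg N := by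
  classical
  exact if h : ∃ d : SuperAlg N, ∀ l : SuperAlg N →ₗ[ℝ] ℝ,
      HasDerivAt (fun y => l (g y)) (l d) x
    then h.choose else 0

/-- Smoothness of a `Λ`-valued function on `ℝ²`. -/
def SmoothLam {N : ℕ} (g : ℝ → ℝ → SuperAlg N) : Prop :=
  ∀ l : SuperAlg N →ₗ[ℝ] ℝ, ContDiff ℝ (⊤ : ℕ∞) (fun p : ℝ × ℝ => l (g p.1 p.2))

namespace SF
variable {N : ℕ}

/-- A superfield is smooth when both components are. -/
def Smooth (f : SF N) : Prop := SmoothLam f.c0 ∧ SmoothLam f.c1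

/-- `∂f`, the `x`-derivative. -/
def dx (f : SF N) : SF N :=
  ⟨fun x t => derLam (fun y => f.c0 y t) x, fun x t => derLam (fun y => f.c1 y t) x⟩

/-- `∂ₜf`, the `t`-derivative. -/
def dt (f : SF N) : SF N :=
  ⟨fun x t => derLam (fun s => f.c0 x s) t, fun x t => derLam (fun s => f.c1 x s) t⟩

/-- The odd superderivative `D`, with `Df = (f₁, ∂ₓf₀)`, so `D ∘ D = ∂`. -/
def Dsd (f : SF N) : SF N := ⟨f.c1, fun x t => derLam (fun y => f.c0 y t) x⟩

end SF

/-- `D^n`. -/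
def Dpow {N : ℕ} : ℕ → SF N → SF N
  | 0, f => f
  | m + 1, f => (Dpow m f).Dsd

/-- `∂^n`. -/
def Xpow {N : ℕ} : ℕ → SF N → SF N
  | 0, f => f
  | m + 1, f => (Xpow m f).dx

/-- `f` has the parity `(−1)^m`. -/
def parityAt {N : ℕ} (f : SF N) (m : ℕ) : Prop :=
  if m % 2 = 0 then f.IsEven else f.IsOdd

/-- The Manin–Radul supersymmetric KdV system. -/
def MRSKdV {N : ℕ} (α u : SF N) : Prop :=
  α.dt = (1/4 : ℝ) • (α.dx.dx + (3:ℝ) • (α * α.Dsd) + (6:ℝ) • (α * u)).dx ∧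
  u.dt = (1/4 : ℝ) • (u.dx.dx + (3:ℝ) • (u * u) + (3:ℝ) • (α * u.Dsd)).dx

/-- The Lax operator `L = ∂² + αD + u`. -/
def Lop {N : ℕ} (α u ψ : SF N) : SF N := ψ.dx.dx + α * ψ.Dsd + u * ψ

/-- The operator `M = (1/2)α∂D + λ∂ + (1/2)u∂ − (1/4)(∂α)D − (1/4)(∂u)`. -/
def Mop {N : ℕ} (α u : SF N) (lam : ℝ) (ψ : SF N) : SF N :=
  (1/2 : ℝ) • (α * ψ.Dsd.dx) + lam • ψ.dx + (1/2 : ℝ) • (u * ψ.dx)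
    - (1/4 : ℝ) • (α.dx * ψ.Dsd) - (1/4 : ℝ) • (u.dx * ψ)

/-- The linear system `Lψ = λψ`, `∂ₜψ = Mψ` associated with `(α,u)` at `λ`. -/
def LinSys {N : ℕ} (α u : SF N) (lam : ℝ) (ψ : SF N) : Prop :=
  Lop α u ψ = lam • ψ ∧ ψ.dt = Mop α u lam ψ

/-- `δ₀ = −(Dθ₀)θ₀⁻¹`. -/
def delta0 {N : ℕ} (θ : SF N) : SF N := -(θ.Dsd * θ.sinv)

/-- The Darboux-transformed `α̂ = −α − 2∂δ₀`. -/
def hatAlpha {N : ℕ} (α θ : SF N) : SF N := -α - (2:ℝ) • (delta0 θ).dx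

/-- The Darboux-transformed `û = u + Dα + 2δ₀(α + ∂δ₀)`. -/
def hatU {N : ℕ} (α u θ : SF N) : SF N :=
  u + α.Dsd + (2:ℝ) • (delta0 θ * (α + (delta0 θ).dx))

/-- `darbIter θ m j = θ_j[m]`, the `j`-th seed after `m` Darboux steps. -/
def darbIter {N : ℕ} (θ : ℕ → SF N) : ℕ → ℕ → SF N
  | 0, j => θ j
  | m + 1, j => (darbIter θ m j).Dsd + delta0 (darbIter θ m m) * darbIter θ m j

/-- `Titer θ n ψ = T_n ψ = (D+δ_{n−1})⋯(D+δ₀)ψ`. -/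
def Titer {N : ℕ} (θ : ℕ → SF N) : ℕ → SF N → SF N
  | 0, ψ => ψ
  | m + 1, ψ => (Titer θ m ψ).Dsd + delta0 (darbIter θ m m) * Titer θ m ψ

/-- Determinant of a matrix of superfields: Leibniz formula with rows in
ascending order (for matrices of commuting, e.g. even, entries this is the usual
determinant, and when exactly one row is odd it agrees with the Laplace
expansion along that row). -/
def detSF {N k : ℕ} (M : Matrix (Fin k) (Fin k) (SF N)) : SF N :=
  ∑ σ : Equiv.Perm (Fin k),
    ((Equiv.Perm.sign σ : ℤ)) • (((List.finRange k).map fun i => M i (σ i)).prod)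

/-- Entrywise `D`-derivative of a matrix of superfields. -/
def DmatSF {N m n : ℕ} (M : Matrix (Fin m) (Fin n) (SF N)) : Matrix (Fin m) (Fin n) (SF N) :=
  Matrix.of fun i j => (M i j).Dsd

/-- The embedding `Fin (k−1) → Fin k` skipping `j`. -/
def dropIdx {k : ℕ} (j : Fin k) (i : Fin (k - 1)) : Fin k :=
  ⟨if i.1 < j.1 then i.1 else i.1 + 1, by
    have h1 := i.2; have h2 := j.2; split <;> omega⟩

/-- The minor of `M` obtained by deleting row `j` and column `i`. -/
def minorSF {N k : ℕ} (M : Matrix (Fin k) (Fin k) (SF N)) (j i : Fin k) :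
    Matrix (Fin (k-1)) (Fin (k-1)) (SF N) :=
  M.submatrix (dropIdx j) (dropIdx i)

/-- Adjugate matrix (matrix of cofactors, transposed). -/
def adjSF {N k : ℕ} (M : Matrix (Fin k) (Fin k) (SF N)) : Matrix (Fin k) (Fin k) (SF N) :=
  Matrix.of fun i j => ((-1 : ℤ) ^ (i.1 + j.1)) • detSF (minorSF M j i)

/-- Inverse of a matrix of (even) superfields, via the adjugate
(junk unless `detSF M` is invertible). -/
def invSF {N k : ℕ} (M : Matrix (Fin k) (Fin k) (SF N)) : Matrix (Fin k) (Fin k) (SF N) :=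
  Matrix.of fun i j => (detSF M).sinv * adjSF M i j

section EvenWronskian

variable {N : ℕ}

/-- `θ^{(0)} = (θ₀, θ₂, …)`. -/
def evenSeq (θ : ℕ → SF N) : ℕ → SF N := fun j => θ (2 * j)

/-- `θ^{(1)} = (θ₁, θ₃, …)`. -/
def oddSeq (θ : ℕ → SF N) : ℕ → SF N := fun j => θ (2 * j + 1)

/-- The `k×k` Wronski matrix with rows `v, ∂v, …, ∂^{k−1}v`. -/
def Wmat (N : ℕ) (k : ℕ) (v : ℕ → SF N) : Matrix (Fin k) (Fin k) (SF N) :=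
  Matrix.of fun i j => Xpow i.1 (v j.1)

/-- The Wronski matrix with last row replaced by `∂^k v`. -/
def WmatHat (N : ℕ) (k : ℕ) (v : ℕ → SF N) : Matrix (Fin k) (Fin k) (SF N) :=
  Matrix.of fun i j => if i.1 = k - 1 then Xpow k (v j.1) else Xpow i.1 (v j.1)

/-- The Wronski matrix with rows `Dv, D∂v, …, D∂^{k−2}v` and last row `∂^k v`. -/
def WmatBarD (N : ℕ) (k : ℕ) (v : ℕ → SF N) : Matrix (Fin k) (Fin k) (SF N) :=
  Matrix.of fun i j => if i.1 = k - 1 then Xpow k (v j.1) else (Xpow i.1 (v j.1)).Dsd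

/-- `W^{(0)}` (even case, `n = 2k`). -/
def W0E (N k : ℕ) (θ : ℕ → SF N) : Matrix (Fin k) (Fin k) (SF N) := Wmat N k (evenSeq θ)

/-- `W^{(1)}` (even case, `n = 2k`). -/
def W1E (N k : ℕ) (θ : ℕ → SF N) : Matrix (Fin k) (Fin k) (SF N) := Wmat N k (oddSeq θ)

/-- The Schur complement `W^{(0)} − W^{(1)}(DW^{(1)})⁻¹DW^{(0)}`. -/
def SchurE (N k : ℕ) (θ : ℕ → SF N) : Matrix (Fin k) (Fin k) (SF N) :=
  W0E N k θ - W1E N k θ * invSF (DmatSF (W1E N k θ)) * DmatSF (W0E N k θ)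

/-- The Schur complement `DW^{(1)} − (DW^{(0)})(W^{(0)})⁻¹W^{(1)}`. -/
def SchurE2 (N k : ℕ) (θ : ℕ → SF N) : Matrix (Fin k) (Fin k) (SF N) :=
  DmatSF (W1E N k θ) - DmatSF (W0E N k θ) * invSF (W0E N k θ) * W1E N k θ

/-- `sdet 𝒲` (even case). -/
def sdetE (N k : ℕ) (θ : ℕ → SF N) : SF N :=
  detSF (SchurE N k θ) * (detSF (DmatSF (W1E N k θ))).sinv

/-- The Schur complement of the block matrix `𝒲̂` (even case). -/
def SchurEHat (N k : ℕ) (θ : ℕ → SF N) : Matrix (Fin k) (Fin k) (SF N) :=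
  WmatHat N k (evenSeq θ) - WmatHat N k (oddSeq θ) * invSF (DmatSF (W1E N k θ)) * DmatSF (W0E N k θ)

/-- `sdet 𝒲̂` (even case). -/
def sdetEHat (N k : ℕ) (θ : ℕ → SF N) : SF N :=
  detSF (SchurEHat N k θ) * (detSF (DmatSF (W1E N k θ))).sinv

end EvenWronskian

section OddWronskian

/-- `W^{(0)}`, a `(k+1)×(k+1)` matrix (odd case, `n = 2k+1`). -/
def W0O (N k : ℕ) (θ : ℕ → SF N) : Matrix (Fin (k+1)) (Fin (k+1)) (SF N) :=
  Matrix.of fun i j => Xpow i.1 (θ (2 * j.1))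

/-- `W^{(1)}`, a `(k+1)×k` matrix (odd case). -/
def W1O (N k : ℕ) (θ : ℕ → SF N) : Matrix (Fin (k+1)) (Fin k) (SF N) :=
  Matrix.of fun i j => Xpow i.1 (θ (2 * j.1 + 1))

/-- `W̃^{(0)}`: `W^{(0)}` with its last row removed. -/
def Wtil0 (N k : ℕ) (θ : ℕ → SF N) : Matrix (Fin k) (Fin (k+1)) (SF N) :=
  Matrix.of fun i j => Xpow i.1 (θ (2 * j.1))

/-- `W̃^{(1)}`: `W^{(1)}` with its last row removed. -/
def Wtil1 (N k : ℕ) (θ : ℕ → SF N) : Matrix (Fin k) (Fin k) (SF N) :=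
  Matrix.of fun i j => Xpow i.1 (θ (2 * j.1 + 1))

/-- `W̌^{(0)}`: `W^{(0)}` with its second-to-last row removed. -/
def Wchk0 (N k : ℕ) (θ : ℕ → SF N) : Matrix (Fin k) (Fin (k+1)) (SF N) :=
  Matrix.of fun i j => Xpow (if i.1 = k - 1 then k else i.1) (θ (2 * j.1))

/-- `W̌^{(1)}`: `W^{(1)}` with its second-to-last row removed. -/
def Wchk1 (N k : ℕ) (θ : ℕ → SF N) : Matrix (Fin k) (Fin k) (SF N) :=
  Matrix.of fun i j => Xpow (if i.1 = k - 1 then k else i.1) (θ (2 * j.1 + 1))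

/-- `Ŵ^{(0)}`: `W^{(0)}` with last row `∂^k θ^{(0)}` replaced by `D∂^k θ^{(0)}`. -/
def W0OHat (N k : ℕ) (θ : ℕ → SF N) : Matrix (Fin (k+1)) (Fin (k+1)) (SF N) :=
  Matrix.of fun i j => if i.1 = k then Dpow (2*k+1) (θ (2 * j.1)) else Xpow i.1 (θ (2 * j.1))

/-- `Ŵ^{(1)}`: `W^{(1)}` with last row `∂^k θ^{(1)}` replaced by `D∂^k θ^{(1)}`. -/
def W1OHat (N k : ℕ) (θ : ℕ → SF N) : Matrix (Fin (k+1)) (Fin k) (SF N) :=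
  Matrix.of fun i j => if i.1 = k then Dpow (2*k+1) (θ (2 * j.1 + 1)) else Xpow i.1 (θ (2 * j.1 + 1))

/-- The Schur complement `W^{(0)} − W^{(1)}(DW̃^{(1)})⁻¹DW̃^{(0)}`. -/
def SchurO (N k : ℕ) (θ : ℕ → SF N) : Matrix (Fin (k+1)) (Fin (k+1)) (SF N) :=
  W0O N k θ - W1O N k θ * invSF (DmatSF (Wtil1 N k θ)) * DmatSF (Wtil0 N k θ)

/-- The Schur complement `W^{(0)} − W^{(1)}(DW̌^{(1)})⁻¹DW̌^{(0)}`. -/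
def SchurOchk (N k : ℕ) (θ : ℕ → SF N) : Matrix (Fin (k+1)) (Fin (k+1)) (SF N) :=
  W0O N k θ - W1O N k θ * invSF (DmatSF (Wchk1 N k θ)) * DmatSF (Wchk0 N k θ)

/-- The Schur complement `Ŵ^{(0)} − Ŵ^{(1)}(DW̃^{(1)})⁻¹DW̃^{(0)}`. -/
def SchurOHat (N k : ℕ) (θ : ℕ → SF N) : Matrix (Fin (k+1)) (Fin (k+1)) (SF N) :=
  W0OHat N k θ - W1OHat N k θ * invSF (DmatSF (Wtil1 N k θ)) * DmatSF (Wtil0 N k θ)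

/-- `sdet 𝒲` (odd case). -/
def sdetO (N k : ℕ) (θ : ℕ → SF N) : SF N :=
  detSF (SchurO N k θ) * (detSF (DmatSF (Wtil1 N k θ))).sinv

/-- `sdet 𝒲̌` (odd case). -/
def sdetOchk (N k : ℕ) (θ : ℕ → SF N) : SF N :=
  detSF (SchurOchk N k θ) * (detSF (DmatSF (Wchk1 N k θ))).sinv

/-- The quotient `det(Ŵ^{(0)} − Ŵ^{(1)}(DW̃^{(1)})⁻¹DW̃^{(0)}) / det(W^{(0)} − W^{(1)}(DW̃^{(1)})⁻¹DW̃^{(0)})`. -/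
def Qodd (N k : ℕ) (θ : ℕ → SF N) : SF N :=
  detSF (SchurOHat N k θ) * (detSF (SchurO N k θ)).sinv

end OddWronskian
set_option linter.unusedVariables false
set_option linter.unusedSimpArgs false

theorem alg_key {A : Type*} [Ring A] [Algebra ℝ A] (Ev Od : A → Prop)
  (hE : ∀ x, Ev x → ∀ z, z * x = x * z) (hO : ∀ x y, Od x → Od y → y * x = -(x * y))
  (hOO : ∀ x, Od x → x * x = 0) (l0 l : ℝ)
  (a1 a3 d1 d3 u u2 a a2 d d2 u1 u3 d4 p0 p1 p2 p3 p4 dt : A)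
  (e_a1 : Ev a1) (e_a3 : Ev a3) (e_d1 : Ev d1) (e_d3 : Ev d3) (e_u : Ev u) (e_u2 : Ev u2)
  (o_a : Od a) (o_a2 : Od a2) (o_d : Od d) (o_d2 : Od d2) (o_u1 : Od u1) (o_u3 : Od u3)
  (hR : l0 • (1:A) = d1 * d1 - a * d + u - d3)
  (hR' : d4 = (2:ℝ) • (d1 * d2) - a1 * d + a * d1 + u1)
  (hp : p4 = l • p0 - a * p1 - u * p0)
  (hdt : dt = -((1/2:ℝ) • (a1 * (-d2 + d * d1)) - (1/2:ℝ) • (a * (-d3 + d1 * d1 - d * d2)) - l0 • d2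
     - (1/2:ℝ) • (u1 * d1) - (1/2:ℝ) • (u * d2) + (1/4:ℝ) • (a3 * d) - (1/4:ℝ) • (a2 * d1) - (1/4:ℝ) • u3)) :
  ((1/2:ℝ) • (a1 * p3 - a * p4) + l • p3 + (1/2:ℝ) • (u1 * p2 + u * p3) - (1/4:ℝ) • (a3 * p1 - a2 * p2)
     - (1/4:ℝ) • (u3 * p0 + u2 * p1))
   + (dt * p0 + d * ((1/2:ℝ) • (a * p3) + l • p2 + (1/2:ℝ) • (u * p2) - (1/4:ℝ) • (a2 * p1) - (1/4:ℝ) • (u2 * p0)))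
  = (1/2:ℝ) • ((-a - (2:ℝ) • d2) * (p4 + (d3 * p0 - d2 * p1) + (d1 * p2 - d * p3))) + l • (p3 + (d2 * p0 + d * p2))
   + (1/2:ℝ) • ((u + a1 + (2:ℝ) • (d * (a + d2))) * (p3 + (d2 * p0 + d * p2)))
   - (1/4:ℝ) • ((-a2 - (2:ℝ) • d4) * (p2 + (d1 * p0 - d * p1)))
   - (1/4:ℝ) • ((u2 + a3 + (2:ℝ) • (d2 * (a + d2) + d * (a2 + d4))) * (p1 + d * p0)) := by
  have L : ∀ x y : A, x * y = y * x → ∀ z, x * (y * z) = y * (x * z) := fun x y h z => by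
    rw [← mul_assoc, h, mul_assoc]
  have LN : ∀ x y : A, x * y = -(y * x) → ∀ z, x * (y * z) = -(y * (x * z)) := fun x y h z => by
    rw [← mul_assoc, h, neg_mul, mul_assoc]
  have Z : ∀ x : A, x * x = 0 → ∀ z, x * (x * z) = 0 := fun x h z => by
    rw [← mul_assoc, h, zero_mul]
  have e : l0 • d2 = (d1 * d1 - a * d + u - d3) * d2 := by rw [← hR]; simp
  rw [hdt, e, hp, hR']
  simp only [mul_add, add_mul, mul_sub, sub_mul, mul_neg, neg_mul, smul_mul_assoc, mul_smul_comm, mul_assoc,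
    smul_add, smul_sub, smul_neg, neg_neg, smul_zero, mul_zero, zero_mul, neg_zero,
    hE _ e_a1 a3, L _ _ (hE _ e_a1 a3),
    hE _ e_a1 d1, L _ _ (hE _ e_a1 d1),
    hE _ e_a1 d3, L _ _ (hE _ e_a1 d3),
    hE _ e_a1 u, L _ _ (hE _ e_a1 u),
    hE _ e_a1 u2, L _ _ (hE _ e_a1 u2),
    hE _ e_a1 a, L _ _ (hE _ e_a1 a),
    hE _ e_a1 a2, L _ _ (hE _ e_a1 a2),
    hE _ e_a1 d, L _ _ (hE _ e_a1 d),
    hE _ e_a1 d2, L _ _ (hE _ e_a1 d2),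
    hE _ e_a1 u1, L _ _ (hE _ e_a1 u1),
    hE _ e_a1 u3, L _ _ (hE _ e_a1 u3),
    hE _ e_a3 d1, L _ _ (hE _ e_a3 d1),
    hE _ e_a3 d3, L _ _ (hE _ e_a3 d3),
    hE _ e_a3 u, L _ _ (hE _ e_a3 u),
    hE _ e_a3 u2, L _ _ (hE _ e_a3 u2),
    hE _ e_a3 a, L _ _ (hE _ e_a3 a),
    hE _ e_a3 a2, L _ _ (hE _ e_a3 a2),
    hE _ e_a3 d, L _ _ (hE _ e_a3 d),
    hE _ e_a3 d2, L _ _ (hE _ e_a3 d2),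
    hE _ e_a3 u1, L _ _ (hE _ e_a3 u1),
    hE _ e_a3 u3, L _ _ (hE _ e_a3 u3),
    hE _ e_d1 d3, L _ _ (hE _ e_d1 d3),
    hE _ e_d1 u, L _ _ (hE _ e_d1 u),
    hE _ e_d1 u2, L _ _ (hE _ e_d1 u2),
    hE _ e_d1 a, L _ _ (hE _ e_d1 a),
    hE _ e_d1 a2, L _ _ (hE _ e_d1 a2),
    hE _ e_d1 d, L _ _ (hE _ e_d1 d),
    hE _ e_d1 d2, L _ _ (hE _ e_d1 d2),
    hE _ e_d1 u1, L _ _ (hE _ e_d1 u1),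
    hE _ e_d1 u3, L _ _ (hE _ e_d1 u3),
    hE _ e_d3 u, L _ _ (hE _ e_d3 u),
    hE _ e_d3 u2, L _ _ (hE _ e_d3 u2),
    hE _ e_d3 a, L _ _ (hE _ e_d3 a),
    hE _ e_d3 a2, L _ _ (hE _ e_d3 a2),
    hE _ e_d3 d, L _ _ (hE _ e_d3 d),
    hE _ e_d3 d2, L _ _ (hE _ e_d3 d2),
    hE _ e_d3 u1, L _ _ (hE _ e_d3 u1),
    hE _ e_d3 u3, L _ _ (hE _ e_d3 u3),
    hE _ e_u u2, L _ _ (hE _ e_u u2),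
    hE _ e_u a, L _ _ (hE _ e_u a),
    hE _ e_u a2, L _ _ (hE _ e_u a2),
    hE _ e_u d, L _ _ (hE _ e_u d),
    hE _ e_u d2, L _ _ (hE _ e_u d2),
    hE _ e_u u1, L _ _ (hE _ e_u u1),
    hE _ e_u u3, L _ _ (hE _ e_u u3),
    hE _ e_u2 a, L _ _ (hE _ e_u2 a),
    hE _ e_u2 a2, L _ _ (hE _ e_u2 a2),
    hE _ e_u2 d, L _ _ (hE _ e_u2 d),
    hE _ e_u2 d2, L _ _ (hE _ e_u2 d2),
    hE _ e_u2 u1, L _ _ (hE _ e_u2 u1),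
    hE _ e_u2 u3, L _ _ (hE _ e_u2 u3),
    hOO _ o_a, Z _ (hOO _ o_a),
    hO _ _ o_a o_a2, LN _ _ (hO _ _ o_a o_a2),
    hO _ _ o_a o_d, LN _ _ (hO _ _ o_a o_d),
    hO _ _ o_a o_d2, LN _ _ (hO _ _ o_a o_d2),
    hO _ _ o_a o_u1, LN _ _ (hO _ _ o_a o_u1),
    hO _ _ o_a o_u3, LN _ _ (hO _ _ o_a o_u3),
    hOO _ o_a2, Z _ (hOO _ o_a2),
    hO _ _ o_a2 o_d, LN _ _ (hO _ _ o_a2 o_d),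
    hO _ _ o_a2 o_d2, LN _ _ (hO _ _ o_a2 o_d2),
    hO _ _ o_a2 o_u1, LN _ _ (hO _ _ o_a2 o_u1),
    hO _ _ o_a2 o_u3, LN _ _ (hO _ _ o_a2 o_u3),
    hOO _ o_d, Z _ (hOO _ o_d),
    hO _ _ o_d o_d2, LN _ _ (hO _ _ o_d o_d2),
    hO _ _ o_d o_u1, LN _ _ (hO _ _ o_d o_u1),
    hO _ _ o_d o_u3, LN _ _ (hO _ _ o_d o_u3),
    hOO _ o_d2, Z _ (hOO _ o_d2),
    hO _ _ o_d2 o_u1, LN _ _ (hO _ _ o_d2 o_u1),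
    hO _ _ o_d2 o_u3, LN _ _ (hO _ _ o_d2 o_u3),
    hOO _ o_u1, Z _ (hOO _ o_u1),
    hO _ _ o_u1 o_u3, LN _ _ (hO _ _ o_u1 o_u3),
    hOO _ o_u3, Z _ (hOO _ o_u3)]
  module


theorem alg_dt {A : Type*} [Ring A] [Algebra ℝ A] (Ev Od : A → Prop)
  (hE : ∀ x, Ev x → ∀ z, z * x = x * z) (hO : ∀ x y, Od x → Od y → y * x = -(x * y))
  (hOO : ∀ x, Od x → x * x = 0) (l : ℝ)
  (a1 a3 d1 d3 u u2 a a2 d d2 u1 u3 p0 p1 p2 p3 p4 dt : A)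
  (e_a1 : Ev a1) (e_a3 : Ev a3) (e_d1 : Ev d1) (e_d3 : Ev d3) (e_u : Ev u) (e_u2 : Ev u2)
  (o_a : Od a) (o_a2 : Od a2) (o_d : Od d) (o_d2 : Od d2) (o_u1 : Od u1) (o_u3 : Od u3)
  (h1 : p1 = -(d * p0)) (h2 : p2 = -(d1 * p0)) (h3 : p3 = -(d2 * p0) + d * (d1 * p0))
  (h4 : p4 = -(d3 * p0) + d1 * (d1 * p0))
  (hdt : dt * p0 = -((1/2:ℝ) • (a1 * p3 - a * p4) + l • p3 + (1/2:ℝ) • (u1 * p2 + u * p3) - (1/4:ℝ) • (a3 * p1 - a2 * p2)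
     - (1/4:ℝ) • (u3 * p0 + u2 * p1))
   - d * ((1/2:ℝ) • (a * p3) + l • p2 + (1/2:ℝ) • (u * p2) - (1/4:ℝ) • (a2 * p1) - (1/4:ℝ) • (u2 * p0))) :
  dt * p0 = -((1/2:ℝ) • (a1 * (-d2 + d * d1)) - (1/2:ℝ) • (a * (-d3 + d1 * d1 - d * d2)) - l • d2
     - (1/2:ℝ) • (u1 * d1) - (1/2:ℝ) • (u * d2) + (1/4:ℝ) • (a3 * d) - (1/4:ℝ) • (a2 * d1) - (1/4:ℝ) • u3) * p0 := by
  have L : ∀ x y : A, x * y = y * x → ∀ z, x * (y * z) = y * (x * z) := fun x y h z => by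
    rw [← mul_assoc, h, mul_assoc]
  have LN : ∀ x y : A, x * y = -(y * x) → ∀ z, x * (y * z) = -(y * (x * z)) := fun x y h z => by
    rw [← mul_assoc, h, neg_mul, mul_assoc]
  have Z : ∀ x : A, x * x = 0 → ∀ z, x * (x * z) = 0 := fun x h z => by
    rw [← mul_assoc, h, zero_mul]
  rw [hdt, h1, h2, h3, h4]
  simp only [mul_add, add_mul, mul_sub, sub_mul, mul_neg, neg_mul, smul_mul_assoc, mul_smul_comm, mul_assoc,
    smul_add, smul_sub, smul_neg, neg_neg, smul_zero, mul_zero, zero_mul, neg_zero,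
    hE _ e_a1 a3, L _ _ (hE _ e_a1 a3),
    hE _ e_a1 d1, L _ _ (hE _ e_a1 d1),
    hE _ e_a1 d3, L _ _ (hE _ e_a1 d3),
    hE _ e_a1 u, L _ _ (hE _ e_a1 u),
    hE _ e_a1 u2, L _ _ (hE _ e_a1 u2),
    hE _ e_a1 a, L _ _ (hE _ e_a1 a),
    hE _ e_a1 a2, L _ _ (hE _ e_a1 a2),
    hE _ e_a1 d, L _ _ (hE _ e_a1 d),
    hE _ e_a1 d2, L _ _ (hE _ e_a1 d2),
    hE _ e_a1 u1, L _ _ (hE _ e_a1 u1),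
    hE _ e_a1 u3, L _ _ (hE _ e_a1 u3),
    hE _ e_a3 d1, L _ _ (hE _ e_a3 d1),
    hE _ e_a3 d3, L _ _ (hE _ e_a3 d3),
    hE _ e_a3 u, L _ _ (hE _ e_a3 u),
    hE _ e_a3 u2, L _ _ (hE _ e_a3 u2),
    hE _ e_a3 a, L _ _ (hE _ e_a3 a),
    hE _ e_a3 a2, L _ _ (hE _ e_a3 a2),
    hE _ e_a3 d, L _ _ (hE _ e_a3 d),
    hE _ e_a3 d2, L _ _ (hE _ e_a3 d2),
    hE _ e_a3 u1, L _ _ (hE _ e_a3 u1),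
    hE _ e_a3 u3, L _ _ (hE _ e_a3 u3),
    hE _ e_d1 d3, L _ _ (hE _ e_d1 d3),
    hE _ e_d1 u, L _ _ (hE _ e_d1 u),
    hE _ e_d1 u2, L _ _ (hE _ e_d1 u2),
    hE _ e_d1 a, L _ _ (hE _ e_d1 a),
    hE _ e_d1 a2, L _ _ (hE _ e_d1 a2),
    hE _ e_d1 d, L _ _ (hE _ e_d1 d),
    hE _ e_d1 d2, L _ _ (hE _ e_d1 d2),
    hE _ e_d1 u1, L _ _ (hE _ e_d1 u1),
    hE _ e_d1 u3, L _ _ (hE _ e_d1 u3),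
    hE _ e_d3 u, L _ _ (hE _ e_d3 u),
    hE _ e_d3 u2, L _ _ (hE _ e_d3 u2),
    hE _ e_d3 a, L _ _ (hE _ e_d3 a),
    hE _ e_d3 a2, L _ _ (hE _ e_d3 a2),
    hE _ e_d3 d, L _ _ (hE _ e_d3 d),
    hE _ e_d3 d2, L _ _ (hE _ e_d3 d2),
    hE _ e_d3 u1, L _ _ (hE _ e_d3 u1),
    hE _ e_d3 u3, L _ _ (hE _ e_d3 u3),
    hE _ e_u u2, L _ _ (hE _ e_u u2),
    hE _ e_u a, L _ _ (hE _ e_u a),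
    hE _ e_u a2, L _ _ (hE _ e_u a2),
    hE _ e_u d, L _ _ (hE _ e_u d),
    hE _ e_u d2, L _ _ (hE _ e_u d2),
    hE _ e_u u1, L _ _ (hE _ e_u u1),
    hE _ e_u u3, L _ _ (hE _ e_u u3),
    hE _ e_u2 a, L _ _ (hE _ e_u2 a),
    hE _ e_u2 a2, L _ _ (hE _ e_u2 a2),
    hE _ e_u2 d, L _ _ (hE _ e_u2 d),
    hE _ e_u2 d2, L _ _ (hE _ e_u2 d2),
    hE _ e_u2 u1, L _ _ (hE _ e_u2 u1),
    hE _ e_u2 u3, L _ _ (hE _ e_u2 u3),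
    hOO _ o_a, Z _ (hOO _ o_a),
    hO _ _ o_a o_a2, LN _ _ (hO _ _ o_a o_a2),
    hO _ _ o_a o_d, LN _ _ (hO _ _ o_a o_d),
    hO _ _ o_a o_d2, LN _ _ (hO _ _ o_a o_d2),
    hO _ _ o_a o_u1, LN _ _ (hO _ _ o_a o_u1),
    hO _ _ o_a o_u3, LN _ _ (hO _ _ o_a o_u3),
    hOO _ o_a2, Z _ (hOO _ o_a2),
    hO _ _ o_a2 o_d, LN _ _ (hO _ _ o_a2 o_d),
    hO _ _ o_a2 o_d2, LN _ _ (hO _ _ o_a2 o_d2),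
    hO _ _ o_a2 o_u1, LN _ _ (hO _ _ o_a2 o_u1),
    hO _ _ o_a2 o_u3, LN _ _ (hO _ _ o_a2 o_u3),
    hOO _ o_d, Z _ (hOO _ o_d),
    hO _ _ o_d o_d2, LN _ _ (hO _ _ o_d o_d2),
    hO _ _ o_d o_u1, LN _ _ (hO _ _ o_d o_u1),
    hO _ _ o_d o_u3, LN _ _ (hO _ _ o_d o_u3),
    hOO _ o_d2, Z _ (hOO _ o_d2),
    hO _ _ o_d2 o_u1, LN _ _ (hO _ _ o_d2 o_u1),
    hO _ _ o_d2 o_u3, LN _ _ (hO _ _ o_d2 o_u3),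
    hOO _ o_u1, Z _ (hOO _ o_u1),
    hO _ _ o_u1 o_u3, LN _ _ (hO _ _ o_u1 o_u3),
    hOO _ o_u3, Z _ (hOO _ o_u3)]
  module

theorem darboux_abs {A : Type*} [Ring A] [Algebra ℝ A] (Ev Od : A → Prop)
  (hE : ∀ x, Ev x → ∀ z, z * x = x * z) (hO : ∀ x y, Od x → Od y → y * x = -(x * y))
  (hOO : ∀ x, Od x → x * x = 0) (D T : A →ₗ[ℝ] A)
  (hDE : ∀ f g, Ev f → D (f * g) = D f * g + f * D g)
  (hDO : ∀ f g, Od f → D (f * g) = D f * g - f * D g)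
  (hT : ∀ f g, T (f * g) = T f * g + f * T g)
  (hTD : ∀ f, T (D f) = D (T f)) (DE : ∀ f, Ev f → Od (D f)) (DO : ∀ f, Od f → Ev (D f))
  (D1 : D 1 = 0) (l0 l : ℝ) (a u θ s d ψ : A) (ha : Od a) (hu : Ev u) (hd : Od d)
  (hs : θ * s = 1) (hδ : d * θ = -(D θ))
  (hL0 : D (D (D (D θ))) + a * D θ + u * θ = l0 • θ)
  (hM0 : T θ = (1/2 : ℝ) • (a * D (D (D θ))) + l0 • D (D θ) + (1/2 : ℝ) • (u * D (D θ))
    - (1/4 : ℝ) • (D (D a) * D θ) - (1/4 : ℝ) • (D (D u) * θ))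
  (hL : D (D (D (D ψ))) + a * D ψ + u * ψ = l • ψ)
  (hM : T ψ = (1/2 : ℝ) • (a * D (D (D ψ))) + l • D (D ψ) + (1/2 : ℝ) • (u * D (D ψ))
    - (1/4 : ℝ) • (D (D a) * D ψ) - (1/4 : ℝ) • (D (D u) * ψ)) :
  T (D ψ + d * ψ) =
    (1/2 : ℝ) • ((-a - (2:ℝ) • D (D d)) * D (D (D (D ψ + d * ψ)))) + l • D (D (D ψ + d * ψ))
    + (1/2 : ℝ) • ((u + D a + (2:ℝ) • (d * (a + D (D d)))) * D (D (D ψ + d * ψ)))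
    - (1/4 : ℝ) • (D (D (-a - (2:ℝ) • D (D d))) * D (D ψ + d * ψ))
    - (1/4 : ℝ) • (D (D (u + D a + (2:ℝ) • (d * (a + D (D d))))) * (D ψ + d * ψ)) := by
  have cancel : ∀ x y : A, x * θ = y * θ → x = y := fun x y h => by
    have := congrArg (· * s) h
    simpa [mul_assoc, hs] using this
  have o_a2 := DE _ (DO _ ha)
  have e_d1 := DO _ hd
  have o_d2 := DE _ e_d1
  have e_d3 := DO _ o_d2
  have o_u1 := DE _ hu
  have e_u2 := DO _ o_u1
  have hDD : ∀ f g, Od f → D (D (f * g)) = D (D f) * g + f * D (D g) := fun f g hf => by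
    rw [hDO _ _ hf, map_sub, hDE _ _ (DO _ hf), hDO _ _ hf]; abel
  have t1 : D θ = -(d * θ) := by rw [hδ, neg_neg]
  have t2 : D (D θ) = -(D d * θ) := by
    rw [t1, map_neg, hDO _ _ hd, t1, mul_neg, ← mul_assoc, hOO _ hd]; simp
  have t3 : D (D (D θ)) = -(D (D d) * θ) + d * (D d * θ) := by
    rw [t1, map_neg, map_neg, hDD _ _ hd, t2]; simp only [mul_neg]; abel
  have t4 : D (D (D (D θ))) = -(D (D (D d)) * θ) + D d * (D d * θ) := by
    rw [t2, map_neg, map_neg, hDE _ _ e_d1, map_add, hDO _ _ o_d2, hDE _ _ e_d1, t2, mul_neg]; abel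
  have hR : l0 • (1:A) = D d * D d - a * d + u - D (D (D d)) := by
    apply cancel
    rw [smul_mul_assoc, one_mul, ← hL0, t4, t1]
    simp only [sub_mul, add_mul, mul_neg, mul_assoc]; abel
  have hR' : D (D (D (D d))) = (2:ℝ) • (D d * D (D d)) - D a * d + a * D d + D u := by
    have h := congrArg D hR
    rw [map_smul, D1, smul_zero, map_sub, map_add, map_sub, hDE _ _ e_d1, hDO _ _ ha,
      ← hE _ e_d1 (D (D d))] at h
    rw [← hE _ e_d1 (D (D d)), ← sub_eq_zero, ← neg_eq_zero, h]
    module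
  have exM : ∀ (c : ℝ) (p : A), D ((1/2 : ℝ) • (a * D (D (D p))) + c • D (D p) + (1/2 : ℝ) • (u * D (D p))
    - (1/4 : ℝ) • (D (D a) * D p) - (1/4 : ℝ) • (D (D u) * p)) =
    (1/2:ℝ) • (D a * D (D (D p)) - a * D (D (D (D p)))) + c • D (D (D p))
      + (1/2:ℝ) • (D u * D (D p) + u * D (D (D p))) - (1/4:ℝ) • (D (D (D a)) * D p - D (D a) * D (D p))
     - (1/4:ℝ) • (D (D (D u)) * p + D (D u) * D p) := fun c p => by
    simp only [map_add, map_sub, map_smul, hDO _ _ ha, hDE _ _ hu, hDO _ _ o_a2, hDE _ _ e_u2]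
  have hdt0 := congrArg T t1
  rw [hTD, map_neg, hT, hM0, exM] at hdt0
  have hdt := cancel _ _ (alg_dt Ev Od hE hO hOO l0 (D a) (D (D (D a))) (D d) (D (D (D d))) u (D (D u)) a (D (D a)) d
    (D (D d)) (D u) (D (D (D u))) θ (D θ) (D (D θ)) (D (D (D θ))) (D (D (D (D θ)))) (T d)
    (DO _ ha) (DO _ o_a2) e_d1 e_d3 hu e_u2 ha o_a2 hd o_d2 o_u1 (DE _ e_u2) t1 t2 t3 t4
    (by rw [hdt0]; abel))
  have hp : D (D (D (D ψ))) = l • ψ - a * D ψ - u * ψ := by rw [← hL]; abel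
  have key := alg_key Ev Od hE hO hOO l0 l (D a) (D (D (D a))) (D d) (D (D (D d))) u (D (D u)) a (D (D a)) d
    (D (D d)) (D u) (D (D (D u))) (D (D (D (D d)))) ψ (D ψ) (D (D ψ)) (D (D (D ψ))) (D (D (D (D ψ)))) (T d)
    (DO _ ha) (DO _ o_a2) e_d1 e_d3 hu e_u2 ha o_a2 hd o_d2 o_u1 (DE _ e_u2) hR hR' hp hdt
  rw [map_add, hTD, hT, hM, exM, key]
  have q1 : D (D ψ + d * ψ) = D (D ψ) + (D d * ψ - d * D ψ) := by rw [map_add, hDO _ _ hd]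
  have q2 : D (D (D ψ + d * ψ)) = D (D (D ψ)) + (D (D d) * ψ + d * D (D ψ)) := by
    rw [map_add, map_add, hDD _ _ hd]
  have q3 : D (D (D (D ψ + d * ψ))) = D (D (D (D ψ))) + (D (D (D d)) * ψ - D (D d) * D ψ)
      + (D d * D (D ψ) - d * D (D (D ψ))) := by
    rw [q2, map_add, map_add, hDO _ _ o_d2, hDO _ _ hd]; abel
  have q4 : D (D (-a - (2:ℝ) • D (D d))) = -D (D a) - (2:ℝ) • D (D (D (D d))) := by
    simp only [map_sub, map_neg, map_smul]
  have q5 : D (D (u + D a + (2:ℝ) • (d * (a + D (D d))))) = D (D u) + D (D (D a)) +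
      (2:ℝ) • (D (D d) * (a + D (D d)) + d * (D (D a) + D (D (D (D d))))) := by
    simp only [map_add, map_smul, hDD _ _ hd]
  rw [q3, q2, q1, q4, q5]


section Aux

variable {N : ℕ}

def bas (N : ℕ) : Module.Basis (Finset (Fin N)) ℝ (SuperAlg N) :=
  (Pi.basisFun ℝ (Fin N)).ExteriorAlgebra

def HasDer (g : ℝ → SuperAlg N) (d : SuperAlg N) (x : ℝ) : Prop :=
  ∀ l : SuperAlg N →ₗ[ℝ] ℝ, HasDerivAt (fun y => l (g y)) (l d) x

theorem sep {a b : SuperAlg N} (h : ∀ l : SuperAlg N →ₗ[ℝ] ℝ, l a = l b) : a = b := by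
  apply (bas N).ext_elem
  intro i
  exact h ((bas N).coord i)

theorem lin_sum (l : SuperAlg N →ₗ[ℝ] ℝ) (a : SuperAlg N) :
    l a = ∑ i, (bas N).coord i a * l (bas N i) := by
  conv_lhs => rw [← (bas N).sum_repr a, map_sum]
  refine Finset.sum_congr rfl fun i _ => ?_
  rw [map_smul]; rfl

theorem lin_mul (l : SuperAlg N →ₗ[ℝ] ℝ) (a b : SuperAlg N) :
    l (a * b) = ∑ i, (bas N).coord i a * ∑ j, (bas N).coord j b * l (bas N i * bas N j) := by
  have h1 := lin_sum (l ∘ₗ LinearMap.mulRight ℝ b) a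
  simp only [LinearMap.comp_apply, LinearMap.mulRight_apply] at h1
  rw [h1]
  refine Finset.sum_congr rfl fun i _ => ?_
  have h2 := lin_sum (l ∘ₗ LinearMap.mulLeft ℝ (bas N i)) b
  simp only [LinearMap.comp_apply, LinearMap.mulLeft_apply] at h2
  rw [h2]

theorem HasDer.derLam {g : ℝ → SuperAlg N} {d : SuperAlg N} {x : ℝ} (h : HasDer g d x) :
    derLam g x = d := by
  have hex : ∃ d : SuperAlg N, ∀ l : SuperAlg N →ₗ[ℝ] ℝ,
      HasDerivAt (fun y => l (g y)) (l d) x := ⟨d, h⟩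
  unfold _root_.derLam
  simp only [dif_pos hex]
  exact sep fun l => (hex.choose_spec l).unique (h l)

theorem derLam_mem {p : Submodule ℝ (SuperAlg N)} {g : ℝ → SuperAlg N} (hg : ∀ y, g y ∈ p)
    (x : ℝ) : derLam g x ∈ p := by
  by_cases hex : ∃ d : SuperAlg N, HasDer g d x
  · obtain ⟨d, hd⟩ := hex
    rw [hd.derLam]
    by_contra hn
    obtain ⟨l, hl, hp⟩ := Submodule.exists_le_ker_of_notMem hn
    apply hl
    have h1 := hd l
    have h2 : (fun y => l (g y)) = fun _ => 0 := funext fun y => hp (hg y)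
    rw [h2] at h1
    exact h1.unique (hasDerivAt_const x 0)
  · have : derLam g x = 0 := by
      unfold derLam
      exact dif_neg hex
    rw [this]; exact p.zero_mem

theorem HasDer.add {g h : ℝ → SuperAlg N} {a b x} (hg : HasDer g a x) (hh : HasDer h b x) :
    HasDer (fun y => g y + h y) (a + b) x := fun l => by
  have := (hg l).fun_add (hh l)
  simp only [map_add]
  exact this

theorem HasDer.smul {g : ℝ → SuperAlg N} {a x} (c : ℝ) (hg : HasDer g a x) :
    HasDer (fun y => c • g y) (c • a) x := fun l => by
  simpa using (hg l).const_mul c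

theorem HasDer.lin {g : ℝ → SuperAlg N} {a x} (f : SuperAlg N →ₗ[ℝ] SuperAlg N)
    (hg : HasDer g a x) : HasDer (fun y => f (g y)) (f a) x := fun l => hg (l ∘ₗ f)

theorem HasDer.mul {g h : ℝ → SuperAlg N} {a b x} (hg : HasDer g a x) (hh : HasDer h b x) :
    HasDer (fun y => g y * h y) (a * h x + g x * b) x := fun l => by
  have e : (fun y => l (g y * h y)) = fun y => ∑ i, (bas N).coord i (g y) *
      ∑ j, (bas N).coord j (h y) * l (bas N i * bas N j) := funext fun y => lin_mul l _ _
  rw [e, map_add, lin_mul l a (h x), lin_mul l (g x) b]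
  rw [← Finset.sum_add_distrib]
  refine HasDerivAt.fun_sum fun i _ => ?_
  exact (hg ((bas N).coord i)).mul
    (HasDerivAt.fun_sum fun j _ => (hh ((bas N).coord j)).mul_const _)

theorem hasDer_of {g : ℝ → SuperAlg N} {x : ℝ}
    (h : ∀ l : SuperAlg N →ₗ[ℝ] ℝ, DifferentiableAt ℝ (fun y => l (g y)) x) :
    HasDer g (derLam g x) x := by
  have : HasDer g (∑ i, deriv (fun y => (bas N).coord i (g y)) x • bas N i) x := fun l => by
    have e : (fun y => l (g y)) = fun y => ∑ i, (bas N).coord i (g y) * l (bas N i) :=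
      funext fun y => lin_sum l _
    rw [e]
    simp only [map_sum, map_smul, smul_eq_mul]
    exact HasDerivAt.fun_sum fun i _ => (h _).hasDerivAt.mul_const _
  rwa [this.derLam]

theorem SmoothLam.fd {g : ℝ → ℝ → SuperAlg N} (hg : SmoothLam g) (l : SuperAlg N →ₗ[ℝ] ℝ) (p : ℝ × ℝ) :
    HasFDerivAt (fun p : ℝ × ℝ => l (g p.1 p.2)) (fderiv ℝ (fun p : ℝ × ℝ => l (g p.1 p.2)) p) p :=
  ((hg l).differentiable (by simp) p).hasFDerivAt

theorem SmoothLam.hx {g : ℝ → ℝ → SuperAlg N} (hg : SmoothLam g) (l : SuperAlg N →ₗ[ℝ] ℝ) (x t : ℝ) :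
    HasDerivAt (fun y => l (g y t)) (fderiv ℝ (fun p : ℝ × ℝ => l (g p.1 p.2)) (x, t) (1, 0)) x :=
  HasFDerivAt.comp_hasDerivAt (f := fun y : ℝ => (y, t)) x (hg.fd l (x, t))
    ((hasDerivAt_id' x).prodMk (hasDerivAt_const x t))

theorem SmoothLam.ht {g : ℝ → ℝ → SuperAlg N} (hg : SmoothLam g) (l : SuperAlg N →ₗ[ℝ] ℝ) (x t : ℝ) :
    HasDerivAt (fun s => l (g x s)) (fderiv ℝ (fun p : ℝ × ℝ => l (g p.1 p.2)) (x, t) (0, 1)) t :=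
  HasFDerivAt.comp_hasDerivAt (f := fun s : ℝ => (x, s)) t (hg.fd l (x, t))
    ((hasDerivAt_const t x).prodMk (hasDerivAt_id' t))

def dX (g : ℝ → ℝ → SuperAlg N) (x t : ℝ) : SuperAlg N := derLam (fun y => g y t) x
def dT (g : ℝ → ℝ → SuperAlg N) (x t : ℝ) : SuperAlg N := derLam (fun s => g x s) t

theorem SmoothLam.hasX {g : ℝ → ℝ → SuperAlg N} (hg : SmoothLam g) (x t : ℝ) :
    HasDer (fun y => g y t) (dX g x t) x := hasDer_of fun l => (hg.hx l x t).differentiableAt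
theorem SmoothLam.hasT {g : ℝ → ℝ → SuperAlg N} (hg : SmoothLam g) (x t : ℝ) :
    HasDer (fun s => g x s) (dT g x t) t := hasDer_of fun l => (hg.ht l x t).differentiableAt

theorem SmoothLam.lX {g : ℝ → ℝ → SuperAlg N} (hg : SmoothLam g) (l : SuperAlg N →ₗ[ℝ] ℝ) (x t : ℝ) :
    l (dX g x t) = fderiv ℝ (fun p : ℝ × ℝ => l (g p.1 p.2)) (x, t) (1, 0) :=
  (hg.hasX x t l).unique (hg.hx l x t)
theorem SmoothLam.lT {g : ℝ → ℝ → SuperAlg N} (hg : SmoothLam g) (l : SuperAlg N →ₗ[ℝ] ℝ) (x t : ℝ) :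
    l (dT g x t) = fderiv ℝ (fun p : ℝ × ℝ => l (g p.1 p.2)) (x, t) (0, 1) :=
  (hg.hasT x t l).unique (hg.ht l x t)

theorem smooth_fd {F : ℝ × ℝ → ℝ} (hF : ContDiff ℝ (⊤ : ℕ∞) F) (v : ℝ × ℝ) :
    ContDiff ℝ (⊤ : ℕ∞) (fun p => fderiv ℝ F p v) :=
  (hF.fderiv_right (m := (⊤ : ℕ∞)) (by norm_cast)).clm_apply contDiff_const

theorem SmoothLam.dX {g : ℝ → ℝ → SuperAlg N} (hg : SmoothLam g) : SmoothLam (dX g) := fun l => by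
  simp only [hg.lX l]; exact smooth_fd (hg l) _
theorem SmoothLam.dT {g : ℝ → ℝ → SuperAlg N} (hg : SmoothLam g) : SmoothLam (dT g) := fun l => by
  simp only [hg.lT l]; exact smooth_fd (hg l) _

theorem dT_dX {g : ℝ → ℝ → SuperAlg N} (hg : SmoothLam g) : dT (dX g) = dX (dT g) := by
  funext x t
  refine sep fun l => ?_
  rw [hg.dX.lT, hg.dT.lX]
  simp only [hg.lX l, hg.lT l]
  have hs : IsSymmSndFDerivAt ℝ (fun p : ℝ × ℝ => l (g p.1 p.2)) (x, t) :=
    (hg l).contDiffAt.isSymmSndFDerivAt (by simp; norm_cast)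
  have hd : DifferentiableAt ℝ (fderiv ℝ (fun p : ℝ × ℝ => l (g p.1 p.2))) (x, t) :=
    (((hg l).fderiv_right (m := (⊤ : ℕ∞)) (by norm_cast)).differentiable (by simp)) _
  have e : ∀ v w : ℝ × ℝ, fderiv ℝ (fun p => fderiv ℝ (fun p : ℝ × ℝ => l (g p.1 p.2)) p v) (x, t) w
      = fderiv ℝ (fderiv ℝ (fun p : ℝ × ℝ => l (g p.1 p.2))) (x, t) w v := fun v w => by
    rw [fderiv_clm_apply hd (differentiableAt_const v)]
    simp
  rw [e, e]
  exact hs _ _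

theorem SmoothLam.add {g h : ℝ → ℝ → SuperAlg N} (hg : SmoothLam g) (hh : SmoothLam h) :
    SmoothLam (fun x t => g x t + h x t) := fun l => by
  simpa using (hg l).add (hh l)
theorem SmoothLam.lin {g : ℝ → ℝ → SuperAlg N} (hg : SmoothLam g) (f : SuperAlg N →ₗ[ℝ] SuperAlg N) :
    SmoothLam (fun x t => f (g x t)) := fun l => hg (l ∘ₗ f)
theorem SmoothLam.mul {g h : ℝ → ℝ → SuperAlg N} (hg : SmoothLam g) (hh : SmoothLam h) :
    SmoothLam (fun x t => g x t * h x t) := fun l => by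
  have e : (fun p : ℝ × ℝ => l (g p.1 p.2 * h p.1 p.2)) = fun p => ∑ i, (bas N).coord i (g p.1 p.2) *
      ∑ j, (bas N).coord j (h p.1 p.2) * l (bas N i * bas N j) := funext fun y => lin_mul l _ _
  rw [e]
  exact ContDiff.sum fun i _ => (hg _).mul (ContDiff.sum fun j _ => (hh _).mul contDiff_const)
theorem smoothLam_const (a : SuperAlg N) : SmoothLam (fun _ _ => a) := fun _ => contDiff_const

theorem contDiff_det {n : Type*} [Fintype n] [DecidableEq n] {M : ℝ × ℝ → Matrix n n ℝ}
    (h : ∀ i j, ContDiff ℝ (⊤ : ℕ∞) (fun p => M p i j)) :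
    ContDiff ℝ (⊤ : ℕ∞) (fun p => (M p).det) := by
  simp only [Matrix.det_apply]
  refine ContDiff.sum fun σ _ => ?_
  exact (contDiff_prod fun i _ => h _ _).const_smul _

theorem SmoothLam.inv {g : ℝ → ℝ → SuperAlg N} (hg : SmoothLam g) (hu : ∀ x t, IsUnit (g x t)) :
    SmoothLam (fun x t => Ring.inverse (g x t)) := fun l => by
  set M : ℝ × ℝ → Matrix (Finset (Fin N)) (Finset (Fin N)) ℝ :=
    fun p => Algebra.leftMulMatrix (bas N) (g p.1 p.2) with hM
  have hMs : ∀ i j, ContDiff ℝ (⊤ : ℕ∞) (fun p => M p i j) := fun i j => by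
    have : (fun p => M p i j) = fun p : ℝ × ℝ =>
        ((bas N).coord i ∘ₗ LinearMap.mulRight ℝ (bas N j)) (g p.1 p.2) := by
      funext p
      simp [hM, Algebra.leftMulMatrix_eq_repr_mul]
    rw [this]; exact hg _
  have hMu : ∀ p, IsUnit (M p) := fun p => (hu p.1 p.2).map (Algebra.leftMulMatrix (bas N))
  have hdet : ∀ p, (M p).det ≠ 0 := fun p => ((Matrix.isUnit_iff_isUnit_det _).1 (hMu p)).ne_zero
  have hcr : ∀ i, ContDiff ℝ (⊤ : ℕ∞) (fun p => (M p).cramer ((bas N).repr 1) i) := fun i => by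
    simp only [Matrix.cramer_apply]
    refine contDiff_det fun a b => ?_
    simp only [Matrix.updateCol_apply]
    split_ifs
    · exact contDiff_const
    · exact hMs _ _
  have hc : ∀ i p, (bas N).coord i (Ring.inverse (g p.1 p.2))
      = (M p).det⁻¹ * (M p).cramer ((bas N).repr 1) i := fun i p => by
    have h1 : (M p).mulVec ((bas N).repr (Ring.inverse (g p.1 p.2))) = (bas N).repr 1 := by
      rw [hM, Algebra.leftMulMatrix_mulVec_repr, Ring.mul_inverse_cancel _ (hu _ _)]
    rw [← h1, Matrix.cramer_eq_adjugate_mulVec, Matrix.mulVec_mulVec, Matrix.adjugate_mul,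
      Matrix.smul_mulVec, Matrix.one_mulVec]
    simp [hdet p]
  have : (fun p : ℝ × ℝ => l (Ring.inverse (g p.1 p.2))) = fun p => 
      ∑ i, ((M p).det⁻¹ * (M p).cramer ((bas N).repr 1) i) * l (bas N i) := by
    funext p
    rw [lin_sum l]
    simp only [hc]
  rw [this]
  exact ContDiff.sum fun i _ => (((contDiff_det hMs).inv hdet).mul (hcr i)).mul contDiff_const

end Aux

section LamFacts

variable {N : ℕ}

def sg (N : ℕ) : SuperAlg N →ₐ[ℝ] SuperAlg N := CliffordAlgebra.involute

theorem sg_even {x : SuperAlg N} (h : x ∈ LambdaEven N) : sg N x = x :=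
  CliffordAlgebra.involute_eq_of_mem_even h
theorem sg_odd {x : SuperAlg N} (h : x ∈ LambdaOdd N) : sg N x = -x :=
  CliffordAlgebra.involute_eq_of_mem_odd h
theorem sg_sg (x : SuperAlg N) : sg N (sg N x) = x :=
  CliffordAlgebra.involute_involute x

theorem lam_split (x : SuperAlg N) : ∃ e ∈ LambdaEven N, ∃ o ∈ LambdaOdd N, e + o = x :=
  Submodule.mem_sup.1 ((CliffordAlgebra.evenOdd_isCompl
    (Q := (0 : QuadraticForm ℝ (Fin N → ℝ)))).sup_eq_top ▸ Submodule.mem_top)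

theorem ee {x y : SuperAlg N} (hx : x ∈ LambdaEven N) (hy : y ∈ LambdaEven N) :
    x * y ∈ LambdaEven N :=
  CliffordAlgebra.evenOdd_mul_le _ 0 0 (Submodule.mul_mem_mul hx hy)
theorem eo {x y : SuperAlg N} (hx : x ∈ LambdaEven N) (hy : y ∈ LambdaOdd N) :
    x * y ∈ LambdaOdd N :=
  CliffordAlgebra.evenOdd_mul_le _ 0 1 (Submodule.mul_mem_mul hx hy)
theorem oe {x y : SuperAlg N} (hx : x ∈ LambdaOdd N) (hy : y ∈ LambdaEven N) :
    x * y ∈ LambdaOdd N :=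
  CliffordAlgebra.evenOdd_mul_le _ 1 0 (Submodule.mul_mem_mul hx hy)
theorem oo {x y : SuperAlg N} (hx : x ∈ LambdaOdd N) (hy : y ∈ LambdaOdd N) :
    x * y ∈ LambdaEven N :=
  CliffordAlgebra.evenOdd_mul_le _ 1 1 (Submodule.mul_mem_mul hx hy)

theorem comm_gen {i j : ZMod 2} {x y : SuperAlg N}
    (hx : x ∈ CliffordAlgebra.evenOdd (0 : QuadraticForm ℝ (Fin N → ℝ)) i)
    (hy : y ∈ CliffordAlgebra.evenOdd (0 : QuadraticForm ℝ (Fin N → ℝ)) j) :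
    x * y = (-1 : ℤˣ) ^ (j * i) • (y * x) := by
  have h := CliffordAlgebra.map_mul_map_of_isOrtho_of_mem_evenOdd
    (QuadraticMap.Isometry.id (0 : QuadraticForm ℝ (Fin N → ℝ)))
    (QuadraticMap.Isometry.id (0 : QuadraticForm ℝ (Fin N → ℝ)))
    (fun a b => by simp [QuadraticMap.isOrtho_def]) x y hx hy
  rw [CliffordAlgebra.map_id] at h
  exact h

theorem even_comm {x : SuperAlg N} (hx : x ∈ LambdaEven N) (z : SuperAlg N) : z * x = x * z := by
  obtain ⟨e, he, o, ho, rfl⟩ := lam_split z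
  have h1 := comm_gen (i := 0) (j := 0) hx he
  have h2 := comm_gen (i := 0) (j := 1) hx ho
  simp at h1 h2
  rw [add_mul, mul_add, h1, h2]

theorem odd_comm {x : SuperAlg N} (hx : x ∈ LambdaOdd N) (z : SuperAlg N) :
    x * z = sg N z * x := by
  obtain ⟨e, he, o, ho, rfl⟩ := lam_split z
  have h1 := comm_gen (i := 1) (j := 0) hx he
  have h2 := comm_gen (i := 1) (j := 1) hx ho
  simp at h1 h2
  rw [map_add, sg_even he, sg_odd ho, add_mul, mul_add, h1, h2, neg_mul]

theorem two_zero {a : SuperAlg N} (h : a = -a) : a = 0 := by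
  have h2 : (2 : ℝ) • a = 0 := by
    rw [two_smul]; nth_rewrite 2 [h]; exact add_neg_cancel a
  exact (smul_eq_zero.1 h2).resolve_left two_ne_zero

theorem odd_sq {x : SuperAlg N} (hx : x ∈ LambdaOdd N) : x * x = 0 := by
  apply two_zero
  have h := odd_comm hx x
  rwa [sg_odd hx, neg_mul] at h

theorem even_of_sg {x : SuperAlg N} (h : sg N x = x) : x ∈ LambdaEven N := by
  obtain ⟨e, he, o, ho, rfl⟩ := lam_split x
  rw [map_add, sg_even he, sg_odd ho] at h
  have h0 : o = 0 := two_zero (add_left_cancel h).symm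
  rw [h0, add_zero]; exact he

theorem even_inv {x : SuperAlg N} (hx : x ∈ LambdaEven N) (hu : IsUnit x) :
    Ring.inverse x ∈ LambdaEven N := by
  apply even_of_sg
  have h1 : x * sg N (Ring.inverse x) = 1 := by
    have := congrArg (sg N) (Ring.mul_inverse_cancel x hu)
    rwa [map_mul, map_one, sg_even hx] at this
  have h2 := Ring.inverse_mul_cancel x hu
  calc sg N (Ring.inverse x) = Ring.inverse x * (x * sg N (Ring.inverse x)) := by
        rw [← mul_assoc, h2, one_mul]
    _ = _ := by rw [h1, mul_one]

end LamFacts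

section SFRing

variable {N : ℕ}

namespace SF

@[simp] theorem add_c0 (f g : SF N) (x t : ℝ) : (f + g).c0 x t = f.c0 x t + g.c0 x t := rfl
@[simp] theorem add_c1 (f g : SF N) (x t : ℝ) : (f + g).c1 x t = f.c1 x t + g.c1 x t := rfl
@[simp] theorem sub_c0 (f g : SF N) (x t : ℝ) : (f - g).c0 x t = f.c0 x t - g.c0 x t := rfl
@[simp] theorem sub_c1 (f g : SF N) (x t : ℝ) : (f - g).c1 x t = f.c1 x t - g.c1 x t := rfl
@[simp] theorem neg_c0 (f : SF N) (x t : ℝ) : (-f).c0 x t = -f.c0 x t := rfl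
@[simp] theorem neg_c1 (f : SF N) (x t : ℝ) : (-f).c1 x t = -f.c1 x t := rfl
@[simp] theorem zero_c0 (x t : ℝ) : (0 : SF N).c0 x t = 0 := rfl
@[simp] theorem zero_c1 (x t : ℝ) : (0 : SF N).c1 x t = 0 := rfl
@[simp] theorem one_c0 (x t : ℝ) : (1 : SF N).c0 x t = 1 := rfl
@[simp] theorem one_c1 (x t : ℝ) : (1 : SF N).c1 x t = 0 := rfl
@[simp] theorem smul_c0 (r : ℝ) (f : SF N) (x t : ℝ) : (r • f).c0 x t = r • f.c0 x t := rfl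
@[simp] theorem smul_c1 (r : ℝ) (f : SF N) (x t : ℝ) : (r • f).c1 x t = r • f.c1 x t := rfl
@[simp] theorem mul_c0 (f g : SF N) (x t : ℝ) : (f * g).c0 x t = f.c0 x t * g.c0 x t := rfl
@[simp] theorem mul_c1 (f g : SF N) (x t : ℝ) :
    (f * g).c1 x t = f.c1 x t * g.c0 x t + sg N (f.c0 x t) * g.c1 x t := rfl

theorem ext' {f g : SF N} (h0 : ∀ x t, f.c0 x t = g.c0 x t) (h1 : ∀ x t, f.c1 x t = g.c1 x t) :
    f = g := SF.ext (funext fun x => funext fun t => h0 x t) (funext fun x => funext fun t => h1 x t)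

instance instRing : Ring (SF N) :=
  { (inferInstance : AddCommGroup (SF N)) with
    mul := (· * ·)
    one := 1
    mul_assoc := fun a b c => ext' (fun x t => by simp [mul_assoc])
      (fun x t => by simp [mul_assoc, add_mul, mul_add, add_assoc])
    one_mul := fun a => ext' (fun x t => by simp) (fun x t => by simp)
    mul_one := fun a => ext' (fun x t => by simp) (fun x t => by simp)
    zero_mul := fun a => ext' (fun x t => by simp) (fun x t => by simp)
    mul_zero := fun a => ext' (fun x t => by simp) (fun x t => by simp)
    left_distrib := fun a b c => ext' (fun x t => by simp [mul_add])
      (fun x t => by simp [mul_add]; abel)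
    right_distrib := fun a b c => ext' (fun x t => by simp [add_mul])
      (fun x t => by simp [add_mul]; abel) }

instance instModule : Module ℝ (SF N) where
  one_smul a := ext' (fun x t => by simp) (fun x t => by simp)
  mul_smul a b c := ext' (fun x t => by simp [mul_smul]) (fun x t => by simp [mul_smul])
  smul_zero a := ext' (fun x t => by simp) (fun x t => by simp)
  smul_add a b c := ext' (fun x t => by simp) (fun x t => by simp)
  add_smul a b c := ext' (fun x t => by simp [add_smul]) (fun x t => by simp [add_smul])
  zero_smul a := ext' (fun x t => by simp) (fun x t => by simp)

instance instAlgebra : Algebra ℝ (SF N) :=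
  Algebra.ofModule
    (fun r a b => ext' (fun x t => by simp) (fun x t => by simp [smul_add]))
    (fun r a b => ext' (fun x t => by simp) (fun x t => by simp [smul_add]))

/-- Smooth superfields. -/
def SA (N : ℕ) : Subalgebra ℝ (SF N) where
  carrier := {f | f.Smooth}
  mul_mem' := fun {f g} hf hg =>
    ⟨hf.1.mul hg.1, (hf.2.mul hg.1).add ((hf.1.lin (sg N).toLinearMap).mul hg.2)⟩
  add_mem' := fun {f g} hf hg => ⟨hf.1.add hg.1, hf.2.add hg.2⟩
  algebraMap_mem' := fun r => by
    rw [Algebra.algebraMap_eq_smul_one]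
    refine ⟨smoothLam_const (r • 1), smoothLam_const (r • 0)⟩

def DA (N : ℕ) : SA N →ₗ[ℝ] SA N where
  toFun f := ⟨f.1.Dsd, f.2.2, f.2.1.dX⟩
  map_add' f g := Subtype.ext <| ext' (fun x t => rfl) fun x t =>
    ((f.2.1.hasX x t).add (g.2.1.hasX x t)).derLam
  map_smul' r f := Subtype.ext <| ext' (fun x t => rfl) fun x t =>
    ((f.2.1.hasX x t).smul r).derLam

def TA (N : ℕ) : SA N →ₗ[ℝ] SA N where
  toFun f := ⟨f.1.dt, f.2.1.dT, f.2.2.dT⟩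
  map_add' f g := Subtype.ext <| ext' (fun x t => ((f.2.1.hasT x t).add (g.2.1.hasT x t)).derLam)
    fun x t => ((f.2.2.hasT x t).add (g.2.2.hasT x t)).derLam
  map_smul' r f := Subtype.ext <| ext' (fun x t => ((f.2.1.hasT x t).smul r).derLam)
    fun x t => ((f.2.2.hasT x t).smul r).derLam

theorem Dsd_c0 (f : SF N) (x t : ℝ) : f.Dsd.c0 x t = f.c1 x t := rfl
theorem Dsd_c1 (f : SF N) (x t : ℝ) : f.Dsd.c1 x t = dX f.c0 x t := rfl

theorem Dsd_mul_c1 {f g : SF N} (hf : f.Smooth) (hg : g.Smooth) (x t : ℝ) :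
    dX (f * g).c0 x t = dX f.c0 x t * g.c0 x t + f.c0 x t * dX g.c0 x t :=
  ((hf.1.hasX x t).mul (hg.1.hasX x t)).derLam

theorem hDE {f g : SF N} (hf : f.Smooth) (hg : g.Smooth) (he : f.IsEven) :
    (f * g).Dsd = f.Dsd * g + f * g.Dsd :=
  ext' (fun x t => by
      simp only [Dsd_c0, mul_c0, mul_c1, add_c0, sg_even (he.1 x t)])
    (fun x t => by
      simp only [Dsd_c0, Dsd_c1, Dsd_mul_c1 hf hg, mul_c1, add_c1, sg_even (he.1 x t),
        sg_odd (he.2 x t), neg_mul]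
      abel)

theorem hDO {f g : SF N} (hf : f.Smooth) (hg : g.Smooth) (he : f.IsOdd) :
    (f * g).Dsd = f.Dsd * g - f * g.Dsd :=
  ext' (fun x t => by
      simp only [Dsd_c0, mul_c0, mul_c1, sub_c0, sg_odd (he.1 x t), neg_mul]
      abel)
    (fun x t => by
      simp only [Dsd_c0, Dsd_c1, Dsd_mul_c1 hf hg, mul_c1, sub_c1, sg_odd (he.1 x t),
        sg_even (he.2 x t), neg_mul]
      abel)

theorem hTmul {f g : SF N} (hf : f.Smooth) (hg : g.Smooth) :
    (f * g).dt = f.dt * g + f * g.dt :=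
  ext' (fun x t => ((hf.1.hasT x t).mul (hg.1.hasT x t)).derLam)
    (fun x t => by
      have h := (((hf.2.hasT x t).mul (hg.1.hasT x t)).add
        (((hf.1.hasT x t).lin (sg N).toLinearMap).mul (hg.2.hasT x t))).derLam
      refine Eq.trans h ?_
      simp only [mul_c1, add_c1, AlgHom.toLinearMap_apply]
      change _ = dT f.c1 x t * g.c0 x t + sg N (dT f.c0 x t) * g.c1 x t
        + (f.c1 x t * dT g.c0 x t + sg N (f.c0 x t) * dT g.c1 x t)
      abel)

theorem hTD {f : SF N} (hf : f.Smooth) : f.Dsd.dt = f.dt.Dsd :=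
  ext' (fun x t => rfl) (fun x t => congrFun (congrFun (dT_dX hf.1) x) t)

theorem DE {f : SF N} (he : f.IsEven) : f.Dsd.IsOdd :=
  ⟨he.2, fun x t => derLam_mem (fun y => he.1 y t) x⟩
theorem DO {f : SF N} (he : f.IsOdd) : f.Dsd.IsEven :=
  ⟨he.2, fun x t => derLam_mem (fun y => he.1 y t) x⟩

theorem ev_comm {f : SF N} (he : f.IsEven) (z : SF N) : z * f = f * z :=
  ext' (fun x t => even_comm (he.1 x t) _) (fun x t => by
    simp only [mul_c1, sg_even (he.1 x t), even_comm (he.1 x t), odd_comm (he.2 x t)]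
    abel)

theorem od_comm {f g : SF N} (hf : f.IsOdd) (hg : g.IsOdd) : g * f = -(f * g) :=
  ext' (fun x t => by
    simp only [mul_c0, neg_c0]
    rw [odd_comm (hg.1 x t), sg_odd (hf.1 x t), neg_mul]) (fun x t => by
    simp only [mul_c1, neg_c1, sg_odd (hf.1 x t), sg_odd (hg.1 x t), neg_mul, mul_neg,
      even_comm (hf.2 x t)]
    rw [← even_comm (hg.2 x t)]
    abel)

theorem od_sq {f : SF N} (hf : f.IsOdd) : f * f = 0 :=
  ext' (fun x t => odd_sq (hf.1 x t)) (fun x t => by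
    simp only [mul_c1, zero_c1, sg_odd (hf.1 x t), neg_mul, mul_neg, even_comm (hf.2 x t)]
    abel)

theorem Dsd_one : (1 : SF N).Dsd = 0 :=
  ext' (fun x t => rfl) (fun x t =>
    HasDer.derLam (fun l => by simpa using hasDerivAt_const x (l 1)))


theorem mul_sinv {θ : SF N} (he : θ.IsEven) (hi : θ.Invertible) : θ * θ.sinv = 1 :=
  ext' (fun x t => Ring.mul_inverse_cancel _ (hi x t)) (fun x t => by
    have h : CliffordAlgebra.involute (θ.c0 x t) = θ.c0 x t := sg_even (he.1 x t)
    simp only [mul_c1, one_c1, sg_even (he.1 x t), sinv, h, mul_neg]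
    rw [mul_assoc, ← mul_assoc (θ.c0 x t), Ring.mul_inverse_cancel _ (hi x t), one_mul,
      add_neg_cancel])

theorem sinv_even {θ : SF N} (he : θ.IsEven) (hi : θ.Invertible) : θ.sinv.IsEven :=
  ⟨fun x t => even_inv (he.1 x t) (hi x t), fun x t => by
    have h : CliffordAlgebra.involute (θ.c0 x t) = θ.c0 x t := sg_even (he.1 x t)
    simp only [sinv, h]
    exact Submodule.neg_mem _ (oe (eo (even_inv (he.1 x t) (hi x t)) (he.2 x t))
      (even_inv (he.1 x t) (hi x t)))⟩

theorem sinv_smooth {θ : SF N} (he : θ.IsEven) (hi : θ.Invertible) (hs : θ.Smooth) : θ.sinv.Smooth := by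
  have h0 := hs.1.inv hi
  refine ⟨h0, ?_⟩
  have h : θ.sinv.c1 = fun x t => -(Ring.inverse (θ.c0 x t) * θ.c1 x t * Ring.inverse (θ.c0 x t)) := by
    funext x t
    have h : CliffordAlgebra.involute (θ.c0 x t) = θ.c0 x t := sg_even (he.1 x t)
    simp only [sinv, h]
  rw [h]
  exact ((h0.mul hs.2).mul h0).lin (-LinearMap.id)

theorem delta0_odd {θ : SF N} (he : θ.IsEven) (hi : θ.Invertible) : (delta0 θ).IsOdd := by
  have h1 := DE he
  have h2 := sinv_even he hi
  refine ⟨fun x t => Submodule.neg_mem _ (oe (h1.1 x t) (h2.1 x t)), fun x t => ?_⟩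
  refine Submodule.neg_mem _ (Submodule.add_mem _ (ee (h1.2 x t) (h2.1 x t)) ?_)
  change sg N (θ.Dsd.c0 x t) * _ ∈ _
  rw [sg_odd (h1.1 x t), neg_mul]
  exact Submodule.neg_mem _ (oo (h1.1 x t) (h2.2 x t))

theorem delta0_mul {θ : SF N} (he : θ.IsEven) (hi : θ.Invertible) : delta0 θ * θ = -θ.Dsd := by
  rw [delta0, neg_mul, mul_assoc, ev_comm he, mul_sinv he hi, mul_one]

end SF

end SFRing


/-- the Darboux transform `ψ̂ = Dψ + δ₀ψ` satisfies `∂ₜψ̂ = M̂ψ̂`. -/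
theorem statement_2 {N : ℕ} (hN : 1 ≤ N) (α u : SF N)
    (hαo : α.IsOdd) (hue : u.IsEven) (hαs : α.Smooth) (hus : u.Smooth)
    (hMR : MRSKdV α u)
    (lam₀ lam : ℝ) (θ₀ : SF N) (hθe : θ₀.IsEven) (hθi : θ₀.Invertible) (hθs : θ₀.Smooth)
    (hθ : LinSys α u lam₀ θ₀)
    (ψ : SF N) (hψs : ψ.Smooth) (hψ : LinSys α u lam ψ) :
    (ψ.Dsd + delta0 θ₀ * ψ).dt
      = Mop (hatAlpha α θ₀) (hatU α u θ₀) lam (ψ.Dsd + delta0 θ₀ * ψ) := by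
  have hss := SF.sinv_smooth hθe hθi hθs
  let A : SF.SA N := ⟨α, hαs⟩
  let U : SF.SA N := ⟨u, hus⟩
  let Θ : SF.SA N := ⟨θ₀, hθs⟩
  let S : SF.SA N := ⟨θ₀.sinv, hss⟩
  let P : SF.SA N := ⟨ψ, hψs⟩
  let d : SF.SA N := -(SF.DA N Θ * S)
  have key := darboux_abs (A := SF.SA N) (fun f => f.1.IsEven) (fun f => f.1.IsOdd)
    (fun x hx z => Subtype.ext (SF.ev_comm hx z.1))
    (fun x y hx hy => Subtype.ext (SF.od_comm hx hy))
    (fun x hx => Subtype.ext (SF.od_sq hx)) (SF.DA N) (SF.TA N)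
    (fun f g hf => Subtype.ext (SF.hDE f.2 g.2 hf))
    (fun f g hf => Subtype.ext (SF.hDO f.2 g.2 hf))
    (fun f g => Subtype.ext (SF.hTmul f.2 g.2))
    (fun f => Subtype.ext (SF.hTD f.2))
    (fun f hf => SF.DE hf) (fun f hf => SF.DO hf) (Subtype.ext SF.Dsd_one)
    lam₀ lam A U Θ S d P hαo hue (SF.delta0_odd hθe hθi)
    (Subtype.ext (SF.mul_sinv hθe hθi)) (Subtype.ext (SF.delta0_mul hθe hθi))
    (Subtype.ext hθ.1) (Subtype.ext hθ.2) (Subtype.ext hψ.1) (Subtype.ext hψ.2)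
  exact congrArg Subtype.val key
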